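/- With H(x) = (1+|G(x)|²)^{-1/2} and G an orthogonal projection onto the span of orthonormal vectors y₁,…,y_k, the Hessian of H satisfies Hess(H)(x) = H(x)³ (3H(x)² G(x)G(x)^T − Σ_{j=1}^k y_j y_j^T) for all x ∈ ℝ^d. -/

import Mathlib

open RealInnerProductSpace

/-- With `H x = (1 + |G x|²)^{-1/2}` and `G` the orthogonal projection onto the
span of orthonormal vectors `y₁,…,y_k`, the Hessian of `H` (the second
derivative, as a bilinear form) satisfies
`Hess(H)(x)(u,v) = H x ^ 3 * (3 * H x ^ 2 * ⟪G x, u⟫ * ⟪G x, v⟫ - ∑ j, ⟪y j, u⟫ * ⟪y j, v⟫)`,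
which is the bilinear form of the matrix
`H(x)³ (3 H(x)² G(x)G(x)ᵀ − ∑ⱼ yⱼ yⱼᵀ)`. -/
theorem hessian_H_eq (d k : ℕ) (y : Fin k → EuclideanSpace ℝ (Fin d))
    (hy : Orthonormal ℝ y)
    (G : EuclideanSpace ℝ (Fin d) → EuclideanSpace ℝ (Fin d))
    (hG : ∀ x, G x = ∑ j, ⟪y j, x⟫ • y j)
    (H : EuclideanSpace ℝ (Fin d) → ℝ)
    (hH : ∀ x, H x = (1 + ‖G x‖ ^ 2) ^ (-(1 / 2) : ℝ)) :
    ∀ x u v : EuclideanSpace ℝ (Fin d),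
      fderiv ℝ (fun z => fderiv ℝ H z) x u v
        = H x ^ 3 * (3 * H x ^ 2 * ⟪G x, u⟫ * ⟪G x, v⟫
            - ∑ j, ⟪y j, u⟫ * ⟪y j, v⟫) := by
  intro x u v
  obtain ⟨L, hL⟩ : ∃ L : EuclideanSpace ℝ (Fin d) →L[ℝ] EuclideanSpace ℝ (Fin d),
      ∀ x, G x = L x := by
    refine ⟨∑ j, (innerSL ℝ (y j)).smulRight (y j), fun x => ?_⟩
    rw [hG]
    simp
  obtain ⟨B, hB⟩ : ∃ B : EuclideanSpace ℝ (Fin d) →L[ℝ] (EuclideanSpace ℝ (Fin d) →L[ℝ] ℝ),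
      ∀ a b, B a b = ⟪L a, b⟫ :=
    ⟨(innerSL ℝ).comp L, fun a b => by simp⟩
  have hBs : ∀ a b, B a b = ∑ j, ⟪y j, a⟫ * ⟪y j, b⟫ := by
    intro a b
    rw [hB, ← hL, hG, sum_inner]
    simp [real_inner_smul_left]
  have hyG : ∀ j a, ⟪y j, L a⟫ = ⟪y j, a⟫ := by
    intro j a
    rw [← hL, hG]
    exact hy.inner_right_fintype (fun j => ⟪y j, a⟫) j
  have hLL : ∀ a b, ⟪L a, L b⟫ = B a b := by
    intro a b
    rw [← hB, hBs, hBs]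
    simp [hyG]
  have hq : ∀ z, HasFDerivAt (fun z => 1 + ‖G z‖ ^ 2) ((2 : ℝ) • B z) z := by
    intro z
    simp only [hL]
    have h := (L.hasFDerivAt (x := z)).norm_sq.const_add 1
    refine h.congr_fderiv ?_
    ext w
    simp [hLL]
  have hpos : ∀ z, 0 < 1 + ‖G z‖ ^ 2 := fun z => by positivity
  have hH3 : ∀ z, H z ^ 3 = (1 + ‖G z‖ ^ 2) ^ (-(1 / 2) - 1 : ℝ) := by
    intro z
    rw [hH, ← Real.rpow_natCast, ← Real.rpow_mul (hpos z).le]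
    norm_num
  have hH1 : ∀ z, HasFDerivAt H (-(H z ^ 3) • B z) z := by
    intro z
    have h := (hq z).rpow_const (p := (-(1 / 2) : ℝ)) (Or.inl (hpos z).ne')
    rw [← hH3] at h
    have e : H = fun z => (1 + ‖G z‖ ^ 2) ^ (-(1 / 2) : ℝ) := funext hH
    rw [← e] at h
    refine h.congr_fderiv ?_
    ext w
    simp
    ring
  have e1 : (fun z => fderiv ℝ H z) = fun z => -(H z ^ 3) • B z :=
    funext fun z => (hH1 z).fderiv
  have h2 := ((hH1 x).pow 3).neg.smul (B.hasFDerivAt (x := x))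
  have e2 := h2.fderiv
  rw [e1]
  refine (congrArg (fun T => T u v) e2).trans ?_
  rw [← hBs, hL, ← hB, ← hB]
  simp
  ring
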